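/- arXiv:0906.2586 — 2 statements merged into one kernel-verified Lean document; each statement's English description precedes it below -/
import Mathlib

section
/- Suppose the sequence {R_n} is uniformly Lipschitz on each bounded interval (for every M > 0 there is K_M such that |R_n(λ) − R_n(λ')| ≤ K_M|λ − λ'| for all n and all λ, λ' ∈ [0, M] with λ, λ' ≤ b_n) and converges pointwise on [0, ∞) to a continuous function R. Then there exist c ∈ ℝ, θ ≥ 0 and a σ-finite measure Λ₁ on (0, ∞) with ∫₀^∞ (u ∧ u²) Λ₁(du) < ∞ such that R(λ) = cλ − θλ² − ∫₀^∞ (e^{−λu} − 1 + λu) Λ₁(du) for all λ ≥ 0. -/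
open MeasureTheory Filter Topology

/-- The probability generating function of an `ℕ`-valued distribution `p`. -/
noncomputable def pgf (p : ℕ → ℝ) (s : ℝ) : ℝ := ∑' i, p i * s ^ i

/-- `R_n(λ) = n b_n [(1 − λ/b_n) − g_n(1 − λ/b_n)]`. -/
noncomputable def Rseq (p : ℕ → ℕ → ℝ) (b : ℕ → ℝ) (n : ℕ) (l : ℝ) : ℝ :=
  (n : ℝ) * b n * ((1 - l / b n) - pgf (p n) (1 - l / b n))

/-- The remainder `e^t - 1 - t` of the first order expansion of the exponential. -/
noncomputable def expRem (t : ℝ) : ℝ := Real.exp t - 1 - t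

lemma expRem_zero : expRem 0 = 0 := by simp [expRem]

lemma expRem_nonneg (t : ℝ) : 0 ≤ expRem t := by
  have := Real.add_one_le_exp t
  unfold expRem; linarith

lemma expRem_pos {t : ℝ} (ht : t ≠ 0) : 0 < expRem t := by
  have := Real.add_one_lt_exp ht
  unfold expRem; linarith

lemma continuous_expRem : Continuous expRem := by unfold expRem; fun_prop

lemma min_le_four_mul_expRem_neg (u : ℝ) : min u (u ^ 2) ≤ 4 * expRem (-u) := by
  unfold expRem
  rcases le_total u 2 with h | h
  · refine (min_le_right _ _).trans ?_
    have h1 := Real.add_one_le_exp (-(u / 2))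
    have h2 : Real.exp (-u) = Real.exp (-(u / 2)) ^ 2 := by
      rw [← Real.exp_nat_mul]; congr 1; push_cast; ring
    rw [h2]
    nlinarith
  · refine (min_le_left _ _).trans ?_
    have := Real.exp_pos (-u)
    linarith

lemma tendsto_expRem_div_sq : Tendsto (fun t => expRem t / t ^ 2) (𝓝[≠] 0) (𝓝 (1 / 2)) := by
  rw [tendsto_iff_norm_sub_tendsto_zero]
  have hlim : Tendsto (fun t : ℝ => |t|) (𝓝[≠] 0) (𝓝 0) := by
    have : Tendsto (fun t : ℝ => |t|) (𝓝 0) (𝓝 |0|) := continuous_abs.tendsto 0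
    rw [abs_zero] at this
    exact this.mono_left nhdsWithin_le_nhds
  refine squeeze_zero' (Eventually.of_forall fun _ => norm_nonneg _) ?_ hlim
  have hone : ∀ᶠ t : ℝ in 𝓝[≠] 0, |t| ≤ 1 :=
    (hlim.eventually (gt_mem_nhds one_pos)).mono fun _ h => h.le
  filter_upwards [hone, self_mem_nhdsWithin] with t ht ht0
  have ht0' : t ≠ 0 := ht0
  have hb := Real.exp_bound ht (n := 3) (by norm_num)
  norm_num [Finset.sum_range_succ, Nat.factorial] at hb
  have heq : expRem t / t ^ 2 - 1 / 2 = (Real.exp t - (1 + t + t ^ 2 / 2)) / t ^ 2 := by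
    unfold expRem; field_simp; ring
  rw [heq, norm_div, Real.norm_eq_abs, Real.norm_eq_abs, abs_pow, div_le_iff₀ (by positivity)]
  refine hb.trans ?_
  have : 0 ≤ |t| ^ 3 := by positivity
  nlinarith

lemma tendsto_expRem_div_neg_atBot : Tendsto (fun t => expRem t / (-t)) atBot (𝓝 1) := by
  have h : Tendsto (fun t : ℝ => (Real.exp t - 1) * (-t)⁻¹ + 1) atBot (𝓝 ((0 - 1) * 0 + 1)) :=
    ((Real.tendsto_exp_atBot.sub_const 1).mul
      (tendsto_inv_atTop_zero.comp tendsto_neg_atBot_atTop)).add_const 1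
  norm_num at h
  refine h.congr' ?_
  filter_upwards [eventually_lt_atBot 0] with t ht
  have := ht.ne
  unfold expRem
  field_simp
  ring

/-- The continuous extension to `[0, ∞)` of `y ↦ (y ^ l - 1 - l log y) / (y - 1 - log y)`. -/
noncomputable def expRemRatio (l y : ℝ) : ℝ :=
  if y = 0 then l else if y = 1 then l ^ 2 else expRem (l * Real.log y) / expRem (Real.log y)

lemma expRemRatio_zero (l : ℝ) : expRemRatio l 0 = l := by simp [expRemRatio]

lemma expRemRatio_one (l : ℝ) : expRemRatio l 1 = l ^ 2 := by simp [expRemRatio]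

lemma expRemRatio_of_ne {l y : ℝ} (h0 : y ≠ 0) (h1 : y ≠ 1) :
    expRemRatio l y = expRem (l * Real.log y) / expRem (Real.log y) := by
  simp [expRemRatio, h0, h1]

lemma expRem_mul_expRemRatio_exp (l t : ℝ) :
    expRem t * expRemRatio l (Real.exp t) = expRem (l * t) := by
  rcases eq_or_ne t 0 with rfl | ht
  · simp [expRem_zero]
  · rw [expRemRatio_of_ne (Real.exp_ne_zero t) (by simpa using ht), Real.log_exp]
    field_simp [(expRem_pos ht).ne']

lemma continuousAt_expRemRatio_one {l : ℝ} (hl : 0 < l) : ContinuousAt (expRemRatio l) 1 := by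
  rw [continuousAt_iff_punctured_nhds, expRemRatio_one]
  have hlog : Tendsto Real.log (𝓝[≠] 1) (𝓝[≠] 0) := by
    refine tendsto_nhdsWithin_iff.2 ⟨?_, ?_⟩
    · have := (Real.continuousAt_log one_ne_zero).tendsto
      rw [Real.log_one] at this
      exact this.mono_left nhdsWithin_le_nhds
    · have : ∀ᶠ y : ℝ in 𝓝[≠] 1, 0 < y := nhdsWithin_le_nhds (lt_mem_nhds one_pos)
      filter_upwards [this, self_mem_nhdsWithin] with y hy hy1
      exact Real.log_ne_zero_of_pos_of_ne_one hy hy1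
  have hmul : Tendsto (fun t : ℝ => l * t) (𝓝[≠] 0) (𝓝[≠] 0) := by
    refine tendsto_nhdsWithin_iff.2 ⟨?_, ?_⟩
    · have : Tendsto (fun t : ℝ => l * t) (𝓝 0) (𝓝 (l * 0)) := (continuous_const_mul l).tendsto 0
      rw [mul_zero] at this
      exact this.mono_left nhdsWithin_le_nhds
    · filter_upwards [self_mem_nhdsWithin] with t ht
      exact mul_ne_zero hl.ne' ht
  have hquot : Tendsto (fun t => expRem (l * t) / expRem t) (𝓝[≠] 0) (𝓝 (l ^ 2)) := by
    have h := ((tendsto_expRem_div_sq.comp hmul).div tendsto_expRem_div_sq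
      (by norm_num)).const_mul (l ^ 2)
    norm_num at h
    refine h.congr' ?_
    filter_upwards [self_mem_nhdsWithin] with t ht
    have ht : t ≠ 0 := ht
    have := (expRem_pos ht).ne'
    field_simp
  refine (hquot.comp hlog).congr' ?_
  have : ∀ᶠ y : ℝ in 𝓝[≠] 1, 0 < y := nhdsWithin_le_nhds (lt_mem_nhds one_pos)
  filter_upwards [this, self_mem_nhdsWithin] with y hy hy1
  rw [expRemRatio_of_ne hy.ne' hy1, Function.comp_apply]

lemma continuousOn_expRemRatio {l : ℝ} (hl : 0 < l) : ContinuousOn (expRemRatio l) (Set.Ici 0) := by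
  intro y hy
  rcases eq_or_ne y 1 with rfl | h1
  · exact (continuousAt_expRemRatio_one hl).continuousWithinAt
  rcases eq_or_ne y 0 with rfl | h0
  · rw [← continuousWithinAt_sdiff_self, Set.Ici_sdiff_left]
    unfold ContinuousWithinAt
    rw [expRemRatio_zero]
    have hquot : Tendsto (fun t => expRem (l * t) / expRem t) atBot (𝓝 l) := by
      have h := ((tendsto_expRem_div_neg_atBot.comp (tendsto_id.const_mul_atBot hl)).div
        tendsto_expRem_div_neg_atBot (by norm_num)).const_mul l
      norm_num at h
      refine h.congr' ?_
      filter_upwards [eventually_lt_atBot 0] with t ht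
      have ht : t ≠ 0 := ht.ne
      have := (expRem_pos ht).ne'
      field_simp
    refine (hquot.comp Real.tendsto_log_nhdsGT_zero).congr' ?_
    have : ∀ᶠ y : ℝ in 𝓝[>] 0, y < 1 := nhdsWithin_le_nhds (gt_mem_nhds one_pos)
    filter_upwards [this, self_mem_nhdsWithin] with y hy hy0
    rw [expRemRatio_of_ne (ne_of_gt hy0) hy.ne, Function.comp_apply]
  · have hy : 0 < y := lt_of_le_of_ne hy h0.symm
    have hlog := Real.log_ne_zero_of_pos_of_ne_one hy h1
    have hc : ContinuousAt (fun y => expRem (l * Real.log y) / expRem (Real.log y)) y := by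
      have hL := Real.continuousAt_log h0
      exact (continuous_expRem.continuousAt.comp (hL.const_mul l)).div
        (continuous_expRem.continuousAt.comp hL) (expRem_pos hlog).ne'
    refine (hc.congr ?_).continuousWithinAt
    filter_upwards [isOpen_ne.mem_nhds h0, isOpen_ne.mem_nhds h1] with z hz0 hz1
    rw [expRemRatio_of_ne hz0 hz1]

/-- Every sequence of discrete measures with bounded masses on the unit interval has a weak limit
along the hyperfilter. -/
lemma exists_tendsto_tsum_hyperfilter (w : ℕ → ℕ → ℝ) (y : ℕ → ℕ → unitInterval)
    (hw : ∀ n i, 0 ≤ w n i) (hs : ∀ n, Summable (w n)) (C : ℝ) (hC : ∀ n, ∑' i, w n i ≤ C) :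
    ∃ G : Measure unitInterval, IsFiniteMeasure G ∧ ∀ f : C(unitInterval, ℝ),
      Tendsto (fun n => ∑' i, w n i * f (y n i)) (hyperfilter ℕ) (𝓝 (∫ x, f x ∂G)) := by
  let μ : ℕ → Measure unitInterval := fun n =>
    Measure.sum fun i => ENNReal.ofReal (w n i) • Measure.dirac (y n i)
  have hmass : ∀ n, μ n Set.univ = ENNReal.ofReal (∑' i, w n i) := fun n => by
    simp [μ, Measure.sum_apply, ENNReal.ofReal_tsum_of_nonneg (hw n) (hs n)]
  have hfin : ∀ n, IsFiniteMeasure (μ n) := fun n => ⟨by rw [hmass]; exact ENNReal.ofReal_lt_top⟩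
  let ν : ℕ → FiniteMeasure unitInterval := fun n => ⟨μ n, hfin n⟩
  have hν : ∀ n, (ν n).mass ≤ C.toNNReal := fun n => by
    rw [← ENNReal.coe_le_coe, FiniteMeasure.ennreal_mass]
    change μ n Set.univ ≤ _
    rw [hmass]
    exact ENNReal.ofReal_le_ofReal (hC n)
  obtain ⟨G, -, hG⟩ :=
    (isCompact_setOfPred_finiteMeasure_le_of_compactSpace unitInterval
      C.toNNReal).ultrafilter_le_nhds' ((hyperfilter ℕ).map ν)
      (Ultrafilter.mem_map.2 (univ_mem' hν))
  refine ⟨G, inferInstance, fun f => ?_⟩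
  have hlim : Tendsto ν (hyperfilter ℕ) (𝓝 G) := hG
  have := FiniteMeasure.tendsto_iff_forall_integral_tendsto.1 hlim
    (BoundedContinuousFunction.mkOfCompact f)
  refine this.congr fun n => ?_
  change ∫ x, f x ∂(μ n) = _
  rw [integral_sum_dirac (fun _ => ENNReal.ofReal_ne_top)]
  simp [ENNReal.toReal_ofReal (hw n _)]

lemma exists_levy_measure (G : Measure unitInterval) [IsFiniteMeasure G] :
    ∃ Λ : Measure ℝ, SigmaFinite Λ ∧ Λ (Set.Iic 0) = 0 ∧
      (∫⁻ u in Set.Ioi (0 : ℝ), ENNReal.ofReal (min u (u ^ 2)) ∂Λ) < ⊤ ∧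
      ∀ l : ℝ, 0 < l → ∫ x : unitInterval, expRemRatio l x ∂G =
        l * G.real {0} + l ^ 2 * G.real {1}
          + ∫ u in Set.Ioi (0 : ℝ), (Real.exp (-l * u) - 1 + l * u) ∂Λ := by
  let S : Set unitInterval := {0, 1}ᶜ
  have hS : MeasurableSet S := ((Set.toFinite _).measurableSet).compl
  have hSlog : ∀ x ∈ S, Real.log (x : ℝ) < 0 := by
    intro x hx
    simp only [S, Set.mem_compl_iff, Set.mem_insert_iff, Set.mem_singleton_iff, not_or] at hx
    refine Real.log_neg (lt_of_le_of_ne x.2.1 fun h => hx.1 (Subtype.ext h.symm))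
      (lt_of_le_of_ne x.2.2 fun h => hx.2 (Subtype.ext h))
  let T : unitInterval → ℝ := fun x => -Real.log x
  have hT : Measurable T := (Real.measurable_log.comp measurable_subtype_coe).neg
  let ν : Measure ℝ := (G.restrict S).map T
  let d : ℝ → NNReal := fun u => (expRem (-u))⁻¹.toNNReal
  have hd : Measurable d :=
    (continuous_expRem.measurable.comp measurable_neg).inv.real_toNNReal
  have hdm : Measurable fun u => (d u : ENNReal) := hd.coe_nnreal_ennreal
  have hνpos : ∀ᵐ u ∂ν, 0 < u := by
    rw [ae_map_iff hT.aemeasurable measurableSet_Ioi]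
    filter_upwards [ae_restrict_mem hS] with x hx
    exact neg_pos.2 (hSlog x hx)
  let Λ : Measure ℝ := ν.withDensity fun u => d u
  have hΛpos : ∀ᵐ u ∂Λ, u ∈ Set.Ioi (0 : ℝ) :=
    (withDensity_absolutelyContinuous ν _).ae_le hνpos
  have hrestrict : Λ.restrict (Set.Ioi 0) = Λ := Measure.restrict_eq_self_of_ae_mem hΛpos
  refine ⟨Λ, inferInstance, ?_, ?_, ?_⟩
  · rw [← Set.compl_Ioi]
    exact hΛpos
  · rw [hrestrict, lintegral_withDensity_eq_lintegral_mul _ hdm (by fun_prop)]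
    refine lt_of_le_of_lt (lintegral_mono_ae (g := fun _ => ENNReal.ofReal 4) ?_) ?_
    · filter_upwards [hνpos] with u hu
      have hpos := expRem_pos (neg_ne_zero.2 hu.ne')
      change ENNReal.ofReal (expRem (-u))⁻¹ * ENNReal.ofReal _ ≤ _
      rw [← ENNReal.ofReal_mul (inv_nonneg.2 hpos.le)]
      refine ENNReal.ofReal_le_ofReal ?_
      rw [inv_mul_le_iff₀ hpos, mul_comm]
      exact min_le_four_mul_expRem_neg u
    · rw [lintegral_const]
      exact ENNReal.mul_lt_top ENNReal.ofReal_lt_top (measure_lt_top _ _)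
  · intro l hl
    have hcont : Continuous fun x : unitInterval => expRemRatio l x :=
      (continuousOn_expRemRatio hl).comp_continuous continuous_subtype_val fun x => x.2.1
    have hint : Integrable (fun x : unitInterval => expRemRatio l x) G :=
      (BoundedContinuousFunction.mkOfCompact ⟨_, hcont⟩).integrable G
    have hmeas : Measurable fun u : ℝ => d u • (Real.exp (-l * u) - 1 + l * u) :=
      hd.smul (by fun_prop)
    have hjump : ∫ u in Set.Ioi (0 : ℝ), (Real.exp (-l * u) - 1 + l * u) ∂Λ
        = ∫ x in S, expRemRatio l x ∂G := by
      rw [hrestrict, integral_withDensity_eq_integral_smul hd,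
        integral_map hT.aemeasurable hmeas.aestronglyMeasurable]
      refine setIntegral_congr_fun hS fun x hx => ?_
      have hlog := hSlog x hx
      have hx0 : (x : ℝ) ≠ 0 := fun h => by simp [h] at hlog
      have hx1 : (x : ℝ) ≠ 1 := fun h => by simp [h] at hlog
      have hpos := expRem_pos hlog.ne
      simp only [d, T, neg_neg, NNReal.smul_def, smul_eq_mul, expRemRatio_of_ne hx0 hx1]
      rw [Real.coe_toNNReal _ (inv_nonneg.2 hpos.le), div_eq_inv_mul]
      congr 1
      unfold expRem
      rw [neg_mul_neg]
      ring
    rw [hjump, ← integral_add_compl hS hint, add_comm]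
    congr 1
    have hSc : Sᶜ = {0} ∪ {1} := by rw [compl_compl]; rfl
    rw [hSc, setIntegral_union (by simp) (measurableSet_singleton _) hint.integrableOn
      hint.integrableOn, integral_singleton, integral_singleton]
    simp [expRemRatio_zero, expRemRatio_one, mul_comm]

lemma summable_mul_pow {p : ℕ → ℝ} (hp0 : ∀ i, 0 ≤ p i) (hp : HasSum p 1) {s : ℝ}
    (hs0 : 0 ≤ s) (hs1 : s ≤ 1) : Summable fun i => p i * s ^ i :=
  hp.summable.of_nonneg_of_le (fun i => mul_nonneg (hp0 i) (pow_nonneg hs0 i))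
    fun i => mul_le_of_le_one_right (hp0 i) (pow_le_one₀ hs0 hs1)

lemma hasSum_one_sub_pgf {p : ℕ → ℝ} (hp0 : ∀ i, 0 ≤ p i) (hp : HasSum p 1) {s : ℝ}
    (hs0 : 0 ≤ s) (hs1 : s ≤ 1) : HasSum (fun i => p i * (1 - s ^ i)) (1 - pgf p s) := by
  simp only [mul_sub, mul_one]
  exact hp.sub (summable_mul_pow hp0 hp hs0 hs1).hasSum

/-- A distribution has a finite mean as soon as the difference quotients of its generating function
at `1` are bounded, and the mean obeys the same bound. -/
lemma summable_mean_of_one_sub_pgf_le {p : ℕ → ℝ} (hp0 : ∀ i, 0 ≤ p i) (hp : HasSum p 1)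
    {A δ : ℝ} (hδ : 0 < δ) (hδ1 : δ ≤ 1)
    (h : ∀ x, 0 < x → x ≤ δ → 1 - pgf p (1 - x) ≤ A * x) :
    Summable (fun i : ℕ => i * p i) ∧ ∑' i : ℕ, i * p i ≤ A := by
  have hnonneg : ∀ i : ℕ, 0 ≤ i * p i := fun i => mul_nonneg i.cast_nonneg (hp0 i)
  have hsum : ∀ N : ℕ, ∑ i ∈ Finset.range N, i * p i ≤ A := by
    intro N
    have hc : Continuous fun x : ℝ =>
        ∑ i ∈ Finset.range N, (∑ j ∈ Finset.range i, (1 - x) ^ j) * p i := by fun_prop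
    have hlim := (hc.tendsto 0).mono_left (nhdsWithin_le_nhds (s := Set.Ioi 0))
    simp only [sub_zero, one_pow, Finset.sum_const, Finset.card_range, nsmul_eq_mul,
      mul_one] at hlim
    refine le_of_tendsto hlim ?_
    filter_upwards [Ioc_mem_nhdsGT hδ] with x hx
    have hx1 : x ≤ 1 := hx.2.trans hδ1
    have hle := sum_le_hasSum (Finset.range N)
      (fun i _ => mul_nonneg (hp0 i)
        (sub_nonneg.2 (pow_le_one₀ (sub_nonneg.2 hx1) (by linarith [hx.1]))))
      (hasSum_one_sub_pgf hp0 hp (sub_nonneg.2 hx1) (by linarith [hx.1]))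
    refine le_of_mul_le_mul_right ?_ hx.1
    refine le_trans (le_of_eq ?_) (hle.trans (h x hx.1 hx.2))
    rw [Finset.sum_mul]
    refine Finset.sum_congr rfl fun i _ => ?_
    rw [← mul_neg_geom_sum (1 - x) i]
    ring
  have hs := summable_of_sum_range_le hnonneg hsum
  exact ⟨hs, hs.tsum_le_of_sum_range_le hsum⟩

lemma one_sub_pgf_le_mean_mul {p : ℕ → ℝ} (hp0 : ∀ i, 0 ≤ p i) (hp : HasSum p 1)
    (hm : Summable fun i : ℕ => i * p i) {x : ℝ} (hx0 : 0 ≤ x) (hx1 : x ≤ 1) :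
    1 - pgf p (1 - x) ≤ (∑' i : ℕ, i * p i) * x := by
  refine hasSum_le (fun i => ?_)
    (hasSum_one_sub_pgf hp0 hp (sub_nonneg.2 hx1) (by linarith)) (hm.hasSum.mul_right x)
  have := one_add_mul_le_pow (a := -x) (by linarith) i
  rw [← sub_eq_add_neg] at this
  nlinarith [hp0 i]

lemma Rseq_zero {p : ℕ → ℕ → ℝ} {n : ℕ} (hp : HasSum (p n) 1) (b : ℕ → ℝ) :
    Rseq p b n 0 = 0 := by
  simp [Rseq, pgf, hp.tsum_eq]

lemma abs_mean_sub_one_le {p : ℕ → ℕ → ℝ} {b : ℕ → ℝ} {n : ℕ} (hp0 : ∀ i, 0 ≤ p n i)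
    (hp : HasSum (p n) 1) (hn : 1 ≤ n) (hb : 1 ≤ b n) {K : ℝ}
    (hK : ∀ l, 0 ≤ l → l ≤ 1 → |Rseq p b n l| ≤ K * l) :
    Summable (fun i : ℕ => i * p n i) ∧ |n * (∑' i : ℕ, i * p n i - 1)| ≤ K := by
  have hn0 : (0 : ℝ) < n := by exact_mod_cast hn
  have hb0 : 0 < b n := one_pos.trans_le hb
  have hδ : 0 < 1 / b n := by positivity
  have hδ1 : 1 / b n ≤ 1 := by rw [div_le_one hb0]; exact hb
  have key : ∀ x, 0 < x → x ≤ 1 / b n → |n * ((1 - pgf (p n) (1 - x)) - x)| ≤ K * x := by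
    intro x hx hxδ
    have hxb : x * b n ≤ 1 := by rwa [le_div_iff₀ hb0] at hxδ
    have h := hK (x * b n) (by positivity) hxb
    rw [Rseq, mul_div_cancel_right₀ _ hb0.ne'] at h
    have heq : n * b n * (1 - x - pgf (p n) (1 - x))
        = (n * ((1 - pgf (p n) (1 - x)) - x)) * b n := by ring
    rw [heq, abs_mul, abs_of_pos hb0, ← mul_assoc] at h
    exact le_of_mul_le_mul_right h hb0
  obtain ⟨hs, hle⟩ := summable_mean_of_one_sub_pgf_le hp0 hp (A := 1 + K / n) hδ hδ1 (by
    intro x hx hxδ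
    have h := (abs_le.1 (key x hx hxδ)).2
    refine le_of_mul_le_mul_left ?_ hn0
    have : n * ((1 + K / n) * x) = n * x + K * x := by field_simp
    rw [this]
    linarith)
  refine ⟨hs, abs_le.2 ⟨?_, ?_⟩⟩
  · have h := (abs_le.1 (key _ hδ le_rfl)).1
    have h2 := mul_le_mul_of_nonneg_left (one_sub_pgf_le_mean_mul hp0 hp hs hδ.le hδ1) hn0.le
    refine le_of_mul_le_mul_right ?_ hδ
    linarith
  · have h := mul_le_mul_of_nonneg_left hle hn0.le
    have : n * (1 + K / n) = n + K := by field_simp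
    linarith

/-- The identity expressing `Rseq` through the jumps `(i - 1) / b n` of the offspring law. -/
lemma hasSum_expRem {p : ℕ → ℕ → ℝ} {b : ℕ → ℝ} {n : ℕ} (hp0 : ∀ i, 0 ≤ p n i)
    (hp : HasSum (p n) 1) (hb : 0 < b n) (hs : Summable fun i : ℕ => i * p n i)
    {l : ℝ} (hl : 0 ≤ l) :
    HasSum (fun i : ℕ => n * b n * (p n i * expRem (l * ((1 - i) / b n))))
      (l * (n * (∑' i : ℕ, i * p n i - 1))
        - Real.exp (l / b n) * Rseq p b n (b n * (1 - Real.exp (-(l / b n))))) := by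
  set s := Real.exp (-(l / b n)) with hs_def
  have hs1 : s ≤ 1 := Real.exp_le_one_iff.2 (neg_nonpos.2 (by positivity))
  have hexp : Real.exp (l / b n) * s = 1 := by rw [hs_def, ← Real.exp_add]; simp
  have h1 := (summable_mul_pow hp0 hp (Real.exp_pos _).le hs1).hasSum.mul_left (Real.exp (l / b n))
  have h2 := ((h1.sub hp).sub ((hp.sub hs.hasSum).mul_left (l / b n))).mul_left (n * b n)
  convert h2 using 1
  · rfl
  · funext i
    have hpow : Real.exp (l * ((1 - i) / b n)) = Real.exp (l / b n) * s ^ i := by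
      rw [hs_def, ← Real.exp_nat_mul, ← Real.exp_add]
      congr 1
      ring
    rw [expRem, hpow]
    ring
  · have harg : 1 - b n * (1 - s) / b n = s := by
      rw [mul_div_cancel_left₀ _ hb.ne']
      ring
    rw [Rseq, harg, pgf]
    have hl' : n * b n * (l / b n * (1 - ∑' i : ℕ, i * p n i))
        = n * l * (1 - ∑' i : ℕ, i * p n i) := by field_simp
    linear_combination (-n * b n) * hexp + hl'

lemma one_sub_exp_neg_div_mem {b l : ℝ} (hb : 0 < b) (hl : 0 ≤ l) :
    0 ≤ b * (1 - Real.exp (-(l / b))) ∧ b * (1 - Real.exp (-(l / b))) ≤ l := by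
  constructor
  · exact mul_nonneg hb.le (sub_nonneg.2 (Real.exp_le_one_iff.2 (neg_nonpos.2 (by positivity))))
  · have h := Real.add_one_le_exp (-(l / b))
    have h2 : b * (1 - Real.exp (-(l / b))) ≤ b * (l / b) :=
      mul_le_mul_of_nonneg_left (by linarith) hb.le
    rwa [mul_div_cancel₀ _ hb.ne'] at h2

lemma tendsto_mul_one_sub_exp_neg_div {b : ℕ → ℝ} (hbpos : ∀ n, 0 < b n)
    (hb : Tendsto b atTop atTop) (l : ℝ) :
    Tendsto (fun n => b n * (1 - Real.exp (-(l / b n)))) atTop (𝓝 l) := by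
  have hinv : Tendsto (fun n => (b n)⁻¹) atTop (𝓝[≠] 0) :=
    tendsto_nhdsWithin_iff.2 ⟨tendsto_inv_atTop_zero.comp hb,
      Eventually.of_forall fun n => inv_ne_zero (hbpos n).ne'⟩
  have hd : HasDerivAt (fun x : ℝ => 1 - Real.exp (-(l * x))) l 0 := by
    have h := ((((hasDerivAt_id (0 : ℝ)).const_mul l).neg).exp).const_sub 1
    simpa using h
  have := hd.tendsto_slope_zero.comp hinv
  refine this.congr fun n => ?_
  simp [div_eq_mul_inv]

/-- `Rseq` evaluated at the perturbed points `b n * (1 - exp (-l / b n))` still converges. -/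
lemma tendsto_exp_mul_Rseq {p : ℕ → ℕ → ℝ} {b : ℕ → ℝ} (hbpos : ∀ n, 0 < b n)
    (hbtop : Tendsto b atTop atTop) {R : ℝ → ℝ} {l K : ℝ} (hl : 0 ≤ l)
    (hK : ∀ (n : ℕ) (x y : ℝ), x ∈ Set.Icc 0 l → y ∈ Set.Icc 0 l → x ≤ b n → y ≤ b n →
      |Rseq p b n x - Rseq p b n y| ≤ K * |x - y|)
    (hconv : Tendsto (fun n => Rseq p b n l) atTop (𝓝 (R l))) :
    Tendsto (fun n => Real.exp (l / b n) * Rseq p b n (b n * (1 - Real.exp (-(l / b n)))))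
      atTop (𝓝 (R l)) := by
  have hpt := tendsto_mul_one_sub_exp_neg_div hbpos hbtop l
  have hdiff : Tendsto (fun n => Rseq p b n (b n * (1 - Real.exp (-(l / b n)))) - Rseq p b n l)
      atTop (𝓝 0) := by
    have hzero : Tendsto (fun n => K * |b n * (1 - Real.exp (-(l / b n))) - l|) atTop (𝓝 0) := by
      have := ((hpt.sub_const l).abs).const_mul K
      simpa using this
    refine squeeze_zero_norm' ?_ hzero
    filter_upwards [hbtop.eventually_ge_atTop l] with n hn
    obtain ⟨h0, h1⟩ := one_sub_exp_neg_div_mem (hbpos n) hl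
    exact hK n _ _ ⟨h0, h1⟩ ⟨hl, le_rfl⟩ (h1.trans hn) hn
  have hexp : Tendsto (fun n => Real.exp (l / b n)) atTop (𝓝 1) := by
    have : Tendsto (fun n => l / b n) atTop (𝓝 0) := tendsto_const_nhds.div_atTop hbtop
    have h := (Real.continuous_exp.tendsto 0).comp this
    rwa [Real.exp_zero] at h
  simpa using hexp.mul (hdiff.add hconv)

/-- Replacing the only term located to the right of `1` by one located at `1` changes the sum by
a correction of that single term. -/
lemma hasSum_expRemRatio_tsub {w : ℕ → ℝ} {β l a : ℝ}
    (h : HasSum (fun i : ℕ => w i * expRemRatio l (Real.exp ((1 - i) / β))) a) :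
    HasSum (fun i : ℕ => w i * expRemRatio l (Real.exp (-(((i - 1 : ℕ) : ℝ) / β))))
      (a + w 0 * (l ^ 2 - expRemRatio l (Real.exp (1 / β)))) := by
  convert h.add (hasSum_ite_eq (0 : ℕ)
    (w 0 * (l ^ 2 - expRemRatio l (Real.exp (1 / β))))) using 1
  funext i
  rcases i with _ | k
  · simp [expRemRatio_one]
    ring
  · have harg : (1 - ((k + 1 : ℕ) : ℝ)) / β = -((k : ℝ) / β) := by
      push_cast
      ring
    rw [harg]
    simp

theorem stmt0
    (p : ℕ → ℕ → ℝ)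
    (hp0 : ∀ n i, 0 ≤ p n i) (hp1 : ∀ n, ∑' i, p n i = 1)
    (b : ℕ → ℝ) (hbpos : ∀ n, 0 < b n) (hbtop : Tendsto b atTop atTop)
    (R : ℝ → ℝ)
    -- (A) : uniform Lipschitz on each bounded interval
    (hlip : ∀ M > (0 : ℝ), ∃ K : ℝ, ∀ (n : ℕ) (l l' : ℝ),
      l ∈ Set.Icc 0 M → l' ∈ Set.Icc 0 M → l ≤ b n → l' ≤ b n →
      |Rseq p b n l - Rseq p b n l'| ≤ K * |l - l'|)
    -- (A) : pointwise convergence to a continuous function `R` on `[0, ∞)`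
    (hconv : ∀ l : ℝ, 0 ≤ l → Tendsto (fun n => Rseq p b n l) atTop (𝓝 (R l)))
    (hRcont : ContinuousOn R (Set.Ici 0)) :
    ∃ (c θ : ℝ) (Λ : Measure ℝ), 0 ≤ θ ∧ SigmaFinite Λ ∧ Λ (Set.Iic 0) = 0 ∧
      (∫⁻ u in Set.Ioi (0 : ℝ), ENNReal.ofReal (min u (u ^ 2)) ∂Λ) < ⊤ ∧
      ∀ l : ℝ, 0 ≤ l →
        R l = c * l - θ * l ^ 2
          - ∫ u in Set.Ioi (0 : ℝ), (Real.exp (-l * u) - 1 + l * u) ∂Λ := by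
  have hp : ∀ n, HasSum (p n) 1 := fun n => by
    have hs : Summable (p n) := by
      by_contra h
      have := hp1 n
      rw [tsum_eq_zero_of_not_summable h] at this
      exact zero_ne_one this
    exact hp1 n ▸ hs.hasSum
  have hR0 : R 0 = 0 := by
    refine tendsto_nhds_unique (hconv 0 le_rfl) ?_
    simp only [Rseq_zero (hp _) b]
    exact tendsto_const_nhds
  obtain ⟨K, hK⟩ := hlip 1 one_pos
  have hK' : ∀ n, 1 ≤ b n → ∀ l, 0 ≤ l → l ≤ 1 → |Rseq p b n l| ≤ K * l := by
    intro n hn l hl hl1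
    have h := hK n l 0 ⟨hl, hl1⟩ ⟨le_rfl, zero_le_one⟩ (hl1.trans hn) (hbpos n).le
    rwa [Rseq_zero (hp n) b, sub_zero, sub_zero, abs_of_nonneg hl] at h
  obtain ⟨N, hN⟩ : ∃ N, ∀ n, 1 ≤ n + N ∧ 1 ≤ b (n + N) := by
    obtain ⟨N, hN⟩ := eventually_atTop.1
      ((eventually_ge_atTop 1).and (hbtop.eventually_ge_atTop 1))
    exact ⟨N, fun n => hN (n + N) (Nat.le_add_left N n)⟩
  have hshift : Tendsto (fun n => n + N) (hyperfilter ℕ) atTop :=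
    (tendsto_add_atTop_nat N).mono_left Nat.hyperfilter_le_atTop
  let m : ℕ → ℝ := fun n => ∑' i : ℕ, i * p (n + N) i
  have hmean : ∀ n, Summable (fun i : ℕ => i * p (n + N) i) ∧ |(n + N : ℕ) * (m n - 1)| ≤ K :=
    fun n => abs_mean_sub_one_le (hp0 _) (hp _) (hN n).1 (hN n).2 (hK' _ (hN n).2)
  obtain ⟨c, -, hc⟩ := (isCompact_Icc (a := -K) (b := K)).ultrafilter_le_nhds'
    ((hyperfilter ℕ).map fun n => ((n + N : ℕ) : ℝ) * (m n - 1))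
    (Ultrafilter.mem_map.2 (univ_mem' fun n => abs_le.1 (hmean n).2))
  have hc : Tendsto (fun n => ((n + N : ℕ) : ℝ) * (m n - 1)) (hyperfilter ℕ) (𝓝 c) := hc
  let w : ℕ → ℕ → ℝ := fun n i =>
    (n + N : ℕ) * b (n + N) * (p (n + N) i * expRem ((1 - i) / b (n + N)))
  let S : ℝ → ℕ → ℝ := fun l n => l * ((n + N : ℕ) * (m n - 1)) - Real.exp (l / b (n + N)) *
    Rseq p b (n + N) (b (n + N) * (1 - Real.exp (-(l / b (n + N)))))
  have hw0 : ∀ n i, 0 ≤ w n i := fun n i =>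
    mul_nonneg (mul_nonneg (Nat.cast_nonneg _) (hbpos _).le)
      (mul_nonneg (hp0 _ _) (expRem_nonneg _))
  have hwS : ∀ n, HasSum (w n) (S 1 n) := fun n => by
    have h := hasSum_expRem (hp0 _) (hp _) (hbpos _) (hmean n).1 zero_le_one
    simp only [one_mul] at h
    simp only [S, one_mul]
    exact h
  have hS : ∀ l, 0 ≤ l → Tendsto (S l) (hyperfilter ℕ) (𝓝 (l * c - R l)) := by
    intro l hl
    obtain ⟨Kl, hKl⟩ := hlip (l + 1) (by linarith)
    refine (hc.const_mul l).sub ((tendsto_exp_mul_Rseq hbpos hbtop hl (K := Kl) ?_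
      (hconv l hl)).comp hshift)
    exact fun n x y hx hy => hKl n x y ⟨hx.1, by linarith [hx.2]⟩ ⟨hy.1, by linarith [hy.2]⟩
  have hmass : ∀ n, ∑' i, w n i ≤ K + Real.exp 1 * K := by
    intro n
    rw [(hwS n).tsum_eq]
    obtain ⟨h0, h1⟩ := one_sub_exp_neg_div_mem (hbpos (n + N)) zero_le_one
    have hR := hK' _ (hN n).2 _ h0 h1
    have hK0 : 0 ≤ K := (abs_nonneg _).trans (hmean n).2
    have hR2 := hR.trans (mul_le_of_le_one_right hK0 h1)
    have hexp : Real.exp (1 / b (n + N)) ≤ Real.exp 1 :=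
      Real.exp_le_exp.2 ((div_le_one (hbpos _)).2 (hN n).2)
    have hprod := mul_le_mul hexp hR2 (abs_nonneg _) (Real.exp_pos 1).le
    rw [← Real.abs_exp (1 / b (n + N)), ← abs_mul] at hprod
    have h2 := (abs_le.1 hprod).1
    have h3 := (abs_le.1 (hmean n).2).2
    simp only [S]
    linarith
  have hymem : ∀ n i : ℕ, Real.exp (-(((i - 1 : ℕ) : ℝ) / b (n + N))) ∈ unitInterval := fun n i =>
    ⟨(Real.exp_pos _).le, Real.exp_le_one_iff.2
      (neg_nonpos.2 (div_nonneg (Nat.cast_nonneg _) (hbpos _).le))⟩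
  obtain ⟨G, hGfin, hG⟩ := exists_tendsto_tsum_hyperfilter w (fun n i => ⟨_, hymem n i⟩) hw0
    (fun n => (hwS n).summable) _ hmass
  obtain ⟨Λ, hΛσ, hΛ0, hΛint, hΛ⟩ := exists_levy_measure G
  refine ⟨c - G.real {0}, G.real {1}, Λ, measureReal_nonneg, hΛσ, hΛ0, hΛint, fun l hl => ?_⟩
  rcases hl.eq_or_lt with rfl | hl
  · simp [hR0]
  have hcont : Continuous fun x : unitInterval => expRemRatio l x :=
    (continuousOn_expRemRatio hl).comp_continuous continuous_subtype_val fun x => x.2.1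
  have hlim := hG ⟨_, hcont⟩
  have hterm : ∀ n, HasSum
      (fun i : ℕ => w n i * expRemRatio l (Real.exp ((1 - i) / b (n + N)))) (S l n) := by
    intro n
    convert hasSum_expRem (hp0 _) (hp _) (hbpos _) (hmean n).1 hl.le using 2 with i
    simp only [w]
    rw [← expRem_mul_expRemRatio_exp l]
    ring
  have hcorr : Tendsto
      (fun n => w n 0 * (l ^ 2 - expRemRatio l (Real.exp (1 / b (n + N)))))
      (hyperfilter ℕ) (𝓝 0) := by
    have hinv : Tendsto (fun n => 1 / b (n + N)) (hyperfilter ℕ) (𝓝 0) :=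
      (tendsto_const_nhds.div_atTop hbtop).comp hshift
    have hexp : Tendsto (fun n => Real.exp (1 / b (n + N))) (hyperfilter ℕ) (𝓝 1) := by
      have h := (Real.continuous_exp.tendsto 0).comp hinv
      rwa [Real.exp_zero] at h
    have hratio := ((continuousAt_expRemRatio_one hl).tendsto.comp hexp).const_sub (l ^ 2)
    rw [expRemRatio_one, sub_self] at hratio
    refine isBoundedUnder_le_mul_tendsto_zero ?_ hratio
    refine isBoundedUnder_of ⟨K + Real.exp 1 * K, fun n => ?_⟩
    rw [Function.comp_apply, Real.norm_of_nonneg (hw0 n 0)]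
    exact ((hwS n).summable.le_tsum 0 fun i _ => hw0 n i).trans (hmass n)
  have hlim' := ((hS l hl.le).add hcorr).congr fun n => (hasSum_expRemRatio_tsub (hterm n)).tsum_eq.symm
  have heq := tendsto_nhds_unique hlim hlim'
  simp only [ContinuousMap.coe_mk] at heq
  rw [hΛ l hl] at heq
  linarith
end

section
/- Under conditions (C), (D1) and (D2), the pointwise limit G of {G_n} has the representation G(λ) = β₁λ − σ₁λ² − ∫₀^∞ (e^{−λu} − 1 + λu) μ(du) for all λ ≥ 0, where β₁ ∈ ℝ, σ₁ ≥ 0 with 2σ₁ ≥ aγ₀, and μ is a σ-finite measure on (0, ∞) with ∫₀^∞ (u ∧ u²) μ(du) < ∞. -/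
open MeasureTheory Filter Topology

/-- The mean `g'(1) = ∑ i * p i` of an `ℕ`-valued distribution `p`. -/
noncomputable def pgfMean (p : ℕ → ℝ) : ℝ := ∑' i : ℕ, (i : ℝ) * p i

/-- `G_n(λ) = n² [(1 − m_n λ/c_n) − g_n(1 − λ/c_n)]`. -/
noncomputable def Gseq (p : ℕ → ℕ → ℝ) (c : ℕ → ℝ) (n : ℕ) (l : ℝ) : ℝ :=
  (n : ℝ) ^ 2 * ((1 - pgfMean (p n) * l / c n) - pgf (p n) (1 - l / c n))

open scoped ENNReal

/-- The remainder kernel `∫₀¹ (1 - t) e^{-tx} dt`, equal to `(e^{-x} - 1 + x) / x²` off zero. -/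
noncomputable def expKernel (x : ℝ) : ℝ := ∫ t in (0 : ℝ)..1, (1 - t) * Real.exp (-(t * x))

lemma continuous_expKernel : Continuous expKernel := by
  unfold expKernel
  apply intervalIntegral.continuous_parametric_intervalIntegral_of_continuous'
  fun_prop

lemma expKernel_pos (x : ℝ) : 0 < expKernel x := by
  refine intervalIntegral.intervalIntegral_pos_of_pos_on
    (Continuous.intervalIntegrable (by fun_prop) _ _) (fun t ht => ?_) one_pos
  have := ht.2
  exact mul_pos (by linarith) (Real.exp_pos _)

lemma expKernel_zero : expKernel 0 = 1 / 2 := by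
  simp only [expKernel, mul_zero, neg_zero, Real.exp_zero, mul_one]
  rw [intervalIntegral.integral_sub (by simp) (by simp)]
  norm_num

lemma sq_mul_expKernel (x : ℝ) : x ^ 2 * expKernel x = Real.exp (-x) - 1 + x := by
  have hderiv : ∀ t ∈ Set.uIcc (0 : ℝ) 1,
      HasDerivAt (fun t : ℝ => Real.exp (-(t * x)) - x * (1 - t) * Real.exp (-(t * x)))
        (x ^ 2 * ((1 - t) * Real.exp (-(t * x)))) t := by
    intro t _
    have h1 : HasDerivAt (fun t : ℝ => Real.exp (-(t * x))) (Real.exp (-(t * x)) * (-(1 * x))) t :=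
      (((hasDerivAt_id t).mul_const x).neg).exp
    have h2 : HasDerivAt (fun t : ℝ => x * (1 - t)) (x * (-1)) t :=
      ((hasDerivAt_id t).const_sub 1).const_mul x
    convert! h1.sub (h2.mul h1) using 1
    ring
  have h := intervalIntegral.integral_eq_sub_of_hasDerivAt hderiv
    (Continuous.intervalIntegrable (by fun_prop) _ _)
  rw [intervalIntegral.integral_const_mul] at h
  rw [expKernel, h]
  simp
  ring

lemma monotoneOn_exp_neg_sub_one_add :
    MonotoneOn (fun x : ℝ => Real.exp (-x) - 1 + x) (Set.Ici 0) := by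
  intro x hx y _ hxy
  have h1 := Real.add_one_le_exp (x - y)
  have h2 : Real.exp (-x) * Real.exp (x - y) = Real.exp (-y) := by
    rw [← Real.exp_add]; ring_nf
  have h3 : Real.exp (-x) ≤ 1 := Real.exp_le_one_iff.2 (by simpa using hx)
  have h4 := Real.exp_pos (-x)
  simp only
  nlinarith

lemma sq_mul_expKernel_le {x r : ℝ} (hx : 0 ≤ x) (hr : 0 < r) (hr1 : r ≤ 1) :
    r ^ 2 * expKernel x ≤ expKernel (x / r) := by
  rcases hx.eq_or_lt with rfl | hx
  · rw [zero_div]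
    exact mul_le_of_le_one_left (expKernel_pos 0).le (pow_le_one₀ hr.le hr1)
  · have h : x ≤ x / r := by rw [le_div_iff₀ hr]; nlinarith
    have h1 := monotoneOn_exp_neg_sub_one_add hx.le (hx.le.trans h) h
    simp only [← sq_mul_expKernel] at h1
    rw [div_pow, div_mul_eq_mul_div, le_div_iff₀ (by positivity)] at h1
    have : 0 < x ^ 2 := by positivity
    nlinarith

/-- The binomial remainder kernel `∫₀¹ (1 - t) (1 - ty)^j dt`. -/
noncomputable def powKernel (j : ℕ) (y : ℝ) : ℝ := ∫ t in (0 : ℝ)..1, (1 - t) * (1 - t * y) ^ j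

lemma one_sub_pow_taylor (j : ℕ) (y : ℝ) :
    (1 - y) ^ (j + 2) - 1 + (j + 2) * y = (j + 2) * (j + 1) * y ^ 2 * powKernel j y := by
  have hderiv : ∀ t ∈ Set.uIcc (0 : ℝ) 1,
      HasDerivAt (fun t : ℝ => (1 - t * y) ^ (j + 2) - (j + 2) * y * (1 - t) * (1 - t * y) ^ (j + 1))
        ((j + 2) * (j + 1) * y ^ 2 * ((1 - t) * (1 - t * y) ^ j)) t := by
    intro t _
    have h0 : HasDerivAt (fun t : ℝ => 1 - t * y) (-(1 * y)) t :=
      ((hasDerivAt_id t).mul_const y).const_sub 1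
    have h2 : HasDerivAt (fun t : ℝ => (j + 2) * y * (1 - t)) ((j + 2) * y * (-1)) t :=
      ((hasDerivAt_id t).const_sub 1).const_mul _
    convert! (h0.pow (j + 2)).sub (h2.mul (h0.pow (j + 1))) using 1
    push_cast [Pi.pow_apply]
    ring
  have h := intervalIntegral.integral_eq_sub_of_hasDerivAt hderiv
    (Continuous.intervalIntegrable (by fun_prop) _ _)
  rw [intervalIntegral.integral_const_mul] at h
  rw [powKernel, h]
  simp
  ring

lemma powKernel_le_expKernel (j : ℕ) {y : ℝ} (hy : y < 1) :
    powKernel j y ≤ expKernel (j * y) := by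
  refine intervalIntegral.integral_mono_on zero_le_one
    (Continuous.intervalIntegrable (by fun_prop) _ _)
    (Continuous.intervalIntegrable (by fun_prop) _ _) fun t ht => ?_
  have h1 : 0 ≤ 1 - t * y := by nlinarith [ht.1, ht.2]
  have h2 : 0 ≤ 1 - t := by linarith [ht.2]
  have h3 : (1 - t * y) ^ j ≤ Real.exp (-(t * (j * y))) := by
    calc (1 - t * y) ^ j ≤ Real.exp (-(t * y)) ^ j :=
          pow_le_pow_left₀ h1 (by linarith [Real.add_one_le_exp (-(t * y))]) j
      _ = _ := by rw [← Real.exp_nat_mul]; ring_nf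
  gcongr

lemma expKernel_le_powKernel (j : ℕ) {y : ℝ} (hy0 : 0 ≤ y) (hy : y < 1) :
    (1 - y) ^ 2 * expKernel (j * y) ≤ powKernel j y := by
  refine (sq_mul_expKernel_le (by positivity) (by linarith) (by linarith)).trans ?_
  refine intervalIntegral.integral_mono_on zero_le_one
    (Continuous.intervalIntegrable (by fun_prop) _ _)
    (Continuous.intervalIntegrable (by fun_prop) _ _) fun t ht => ?_
  have hy1 : 0 < 1 - y := by linarith
  have h1 : 1 - y ≤ 1 - t * y := by nlinarith [ht.1, ht.2]
  have h1' : 0 < 1 - t * y := by linarith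
  have h2 : 0 ≤ 1 - t := by linarith [ht.2]
  have h4 : Real.exp (-(t * (y / (1 - y)))) ≤ 1 - t * y := by
    rw [Real.exp_neg]
    refine inv_le_of_inv_le₀ h1' (le_trans ?_ (Real.add_one_le_exp _))
    rw [inv_le_iff_one_le_mul₀ h1', mul_div_assoc', div_add_one hy1.ne', div_mul_eq_mul_div,
      le_div_iff₀ hy1]
    have := mul_nonneg ht.1 hy0
    nlinarith [mul_nonneg (mul_nonneg ht.1 hy0) (mul_nonneg h2 hy0)]
  have h3 : Real.exp (-(t * (j * y / (1 - y)))) ≤ (1 - t * y) ^ j := by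
    calc _ = Real.exp (-(t * (y / (1 - y)))) ^ j := by rw [← Real.exp_nat_mul]; ring_nf
      _ ≤ _ := pow_le_pow_left₀ (Real.exp_pos _).le h4 j
  gcongr

/-- Extends `f : [0, ∞) → ℝ` to `[0, ∞]` by the value `b` at infinity. -/
noncomputable def extendTop (f : ℝ → ℝ) (b : ℝ) (v : ℝ≥0∞) : ℝ := if v = ⊤ then b else f v.toReal

lemma continuous_extendTop {f : ℝ → ℝ} {b : ℝ} (hf : ContinuousOn f (Set.Ici 0))
    (hb : Tendsto f atTop (𝓝 b)) : Continuous (extendTop f b) := by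
  rw [continuous_iff_continuousAt]
  intro v
  induction v with
  | top =>
    rw [ContinuousAt, extendTop, if_pos rfl, tendsto_def]
    intro s hs
    obtain ⟨M, hM⟩ := mem_atTop_sets.1 (hb hs)
    filter_upwards [Ioi_mem_nhds (ENNReal.ofReal_lt_top : ENNReal.ofReal M < ⊤)] with w hw
    simp only [Set.mem_preimage, extendTop]
    split_ifs with h
    · exact mem_of_mem_nhds hs
    · exact hM _ ((ENNReal.ofReal_le_iff_le_toReal h).1 (le_of_lt hw))
  | coe r =>
    rw [ENNReal.continuousAt_coe_iff]
    have : extendTop f b ∘ (fun r : NNReal => (r : ℝ≥0∞)) = fun r : NNReal => f r := by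
      ext r; simp [extendTop]
    rw [this]
    exact (hf.comp_continuous NNReal.continuous_coe fun r => r.2).continuousAt

/-- The kernel `v ↦ (e^{-lv} - 1 + lv)(1 + v) / v²`, continuously extended to `[0, ∞]`. -/
noncomputable def levyKernel (l : ℝ) : ℝ≥0∞ → ℝ :=
  extendTop (fun v => l ^ 2 * expKernel (l * v) * (1 + v)) l

lemma levyKernel_eq (l : ℝ) {v : ℝ} (hv : 0 < v) :
    l ^ 2 * expKernel (l * v) * (1 + v) =
      (Real.exp (-(l * v)) - 1 + l * v) * ((1 + v) / v ^ 2) := by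
  rw [← sq_mul_expKernel]
  field_simp

lemma continuous_levyKernel {l : ℝ} (hl : 0 < l) : Continuous (levyKernel l) := by
  refine continuous_extendTop (Continuous.continuousOn ?_) ?_
  · have := continuous_expKernel
    fun_prop
  · have h1 : Tendsto (fun v : ℝ => v⁻¹) atTop (𝓝 0) := tendsto_inv_atTop_zero
    have h2 : Tendsto (fun v : ℝ => Real.exp (-(l * v))) atTop (𝓝 0) :=
      Real.tendsto_exp_neg_atTop_nhds_zero.comp (tendsto_id.const_mul_atTop hl)
    have h3 : Tendsto (fun v : ℝ => (Real.exp (-(l * v)) * v⁻¹ - v⁻¹ + l) * (v⁻¹ + 1)) atTop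
        (𝓝 ((0 * 0 - 0 + l) * (0 + 1))) :=
      (((h2.mul h1).sub h1).add_const l).mul (h1.add_const 1)
    simp only [mul_zero, sub_zero, zero_add, mul_one] at h3
    refine h3.congr' ?_
    filter_upwards [eventually_gt_atTop 0] with v hv
    rw [levyKernel_eq l hv]
    field_simp

lemma levyKernel_pos {l : ℝ} (hl : 0 < l) (v : ℝ≥0∞) : 0 < levyKernel l v := by
  unfold levyKernel extendTop
  split_ifs
  · exact hl
  · have := expKernel_pos (l * v.toReal)
    positivity

lemma exists_le_levyKernel_one : ∃ δ > 0, ∀ v, δ ≤ levyKernel 1 v := by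
  obtain ⟨v, -, hv⟩ := isCompact_univ.exists_isMinOn Set.univ_nonempty
    (continuous_levyKernel one_pos).continuousOn
  exact ⟨_, levyKernel_pos one_pos v, fun w => hv (Set.mem_univ w)⟩

/-- The Lévy measure on `(0, ∞)` obtained from a finite measure on `[0, ∞]` by discarding the
endpoints and applying the density `(1 + u) / u²`. -/
noncomputable def levyMeasure (ρ : Measure ℝ≥0∞) : Measure ℝ :=
  ((ρ.map ENNReal.toReal).restrict (Set.Ioi 0)).withDensity
    fun u => ENNReal.ofReal ((1 + u) / u ^ 2)

lemma measurable_levyDensity : Measurable fun u : ℝ => ENNReal.ofReal ((1 + u) / u ^ 2) := by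
  fun_prop

lemma levyMeasure_Iic (ρ : Measure ℝ≥0∞) : levyMeasure ρ (Set.Iic 0) = 0 := by
  refine withDensity_absolutelyContinuous _ _ ?_
  rw [Measure.restrict_apply measurableSet_Iic, Set.Iic_inter_Ioi, Set.Ioc_self, measure_empty]

lemma sigmaFinite_levyMeasure (ρ : Measure ℝ≥0∞) [IsFiniteMeasure ρ] :
    SigmaFinite (levyMeasure ρ) := by
  have : IsFiniteMeasure (ρ.map ENNReal.toReal) := inferInstance
  unfold levyMeasure
  exact SigmaFinite.withDensity_ofReal _

lemma lintegral_levyMeasure_lt_top (ρ : Measure ℝ≥0∞) [IsFiniteMeasure ρ] :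
    ∫⁻ u in Set.Ioi (0 : ℝ), ENNReal.ofReal (min u (u ^ 2)) ∂levyMeasure ρ < ⊤ := by
  have : IsFiniteMeasure (ρ.map ENNReal.toReal) := inferInstance
  refine (setLIntegral_le_lintegral _ _).trans_lt ?_
  rw [levyMeasure, lintegral_withDensity_eq_lintegral_mul _ measurable_levyDensity (by fun_prop)]
  refine (setLIntegral_mono (g := fun _ => ENNReal.ofReal 2) measurable_const
    fun u hu => ?_).trans_lt ?_
  · have hu : 0 < u := hu
    rw [Pi.mul_apply, ← ENNReal.ofReal_mul (by positivity)]
    refine ENNReal.ofReal_le_ofReal ?_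
    rw [div_mul_eq_mul_div, div_le_iff₀ (by positivity)]
    rcases le_total u 1 with h | h
    · have := min_le_right u (u ^ 2)
      nlinarith [sq_nonneg u]
    · have := min_le_left u (u ^ 2)
      nlinarith
  · rw [lintegral_const]
    exact ENNReal.mul_lt_top ENNReal.ofReal_lt_top (measure_lt_top _ _)

lemma setIntegral_levyMeasure (ρ : Measure ℝ≥0∞) (l : ℝ) :
    ∫ u in Set.Ioi (0 : ℝ), (Real.exp (-l * u) - 1 + l * u) ∂levyMeasure ρ =
      ∫ v in ENNReal.toReal ⁻¹' Set.Ioi 0, levyKernel l v ∂ρ := by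
  have hres : (levyMeasure ρ).restrict (Set.Ioi 0) = levyMeasure ρ := by
    refine Measure.restrict_eq_self_of_ae_mem ?_
    rw [ae_iff]
    convert levyMeasure_Iic ρ using 2
    ext; simp
  rw [hres, levyMeasure, integral_withDensity_eq_integral_toReal_smul measurable_levyDensity
    (by simp)]
  have hmeas : Measurable fun u : ℝ => l ^ 2 * expKernel (l * u) * (1 + u) := by
    have := continuous_expKernel
    exact Continuous.measurable (by fun_prop)
  rw [setIntegral_congr_fun (g := fun u => l ^ 2 * expKernel (l * u) * (1 + u)) measurableSet_Ioi,
    setIntegral_map measurableSet_Ioi hmeas.aestronglyMeasurable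
      ENNReal.measurable_toReal.aemeasurable]
  · refine setIntegral_congr_fun (ENNReal.measurable_toReal measurableSet_Ioi) fun v hv => ?_
    have hv : v ≠ ⊤ := by rintro rfl; simp at hv
    simp [levyKernel, extendTop, hv]
  · intro u hu
    have hu : 0 < u := hu
    beta_reduce
    rw [levyKernel_eq l hu, ENNReal.toReal_ofReal (by positivity), smul_eq_mul, neg_mul]
    ring

lemma integral_levyKernel (ρ : Measure ℝ≥0∞) [IsFiniteMeasure ρ] {l : ℝ} (hl : 0 < l) :
    ∫ v, levyKernel l v ∂ρ = ρ.real {0} * (l ^ 2 / 2) + ρ.real {⊤} * l +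
      ∫ u in Set.Ioi (0 : ℝ), (Real.exp (-l * u) - 1 + l * u) ∂levyMeasure ρ := by
  have hint : Integrable (levyKernel l) ρ :=
    (BoundedContinuousFunction.mkOfCompact ⟨_, continuous_levyKernel hl⟩).integrable ρ
  have hS : MeasurableSet (ENNReal.toReal ⁻¹' Set.Ioi 0) :=
    ENNReal.measurable_toReal measurableSet_Ioi
  have hcompl : (ENNReal.toReal ⁻¹' Set.Ioi 0)ᶜ = {0} ∪ {⊤} := by
    ext v
    simp [ENNReal.toReal_pos_iff, pos_iff_ne_zero, lt_top_iff_ne_top, -not_and, not_and_or,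
      or_comm]
  rw [setIntegral_levyMeasure, ← integral_add_compl hS hint, hcompl,
    setIntegral_union (by simp) (measurableSet_singleton _) hint.integrableOn hint.integrableOn,
    integral_singleton, integral_singleton]
  simp [levyKernel, extendTop, expKernel_zero]
  ring

/-- The mass placed on the atom `j / c` by the rescaled distribution `q`. -/
noncomputable def atomWeight (q : ℕ → ℝ) (c N : ℝ) (j : ℕ) : ℝ :=
  N ^ 2 * (q (j + 2) * ((j + 2) * (j + 1))) / c ^ 2 / (1 + j / c)

/-- The measure on `[0, ∞]` with mass `atomWeight q c N j` at `j / c`. -/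
noncomputable def rescaledMeasure (q : ℕ → ℝ) (c N : ℝ) : Measure ℝ≥0∞ :=
  Measure.sum fun j : ℕ =>
    ENNReal.ofReal (atomWeight q c N j) • Measure.dirac (ENNReal.ofReal (j / c))

section Rescaled

variable {q : ℕ → ℝ} {c N : ℝ}

lemma atomWeight_nonneg (hq : ∀ i, 0 ≤ q i) (hc : 0 < c) (j : ℕ) : 0 ≤ atomWeight q c N j := by
  have := hq (j + 2)
  unfold atomWeight
  positivity

lemma summable_atomWeight (hq : ∀ i, 0 ≤ q i) (hm : Summable fun i : ℕ => (i : ℝ) * q i)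
    (hc : 0 < c) : Summable (atomWeight q c N) := by
  refine Summable.of_nonneg_of_le (atomWeight_nonneg hq hc) (fun j => ?_)
    (((summable_nat_add_iff 2).2 hm).mul_left (N ^ 2 / c ^ 2 * (c + 1)))
  have hqj := hq (j + 2)
  have h : ((j : ℝ) + 1) ≤ (c + 1) * (1 + j / c) := by
    have h1 : 0 ≤ (j : ℝ) / c := by positivity
    have h2 : (c + 1) * (1 + j / c) = c + 1 + j + j / c := by field_simp; ring
    linarith
  unfold atomWeight
  rw [div_le_iff₀ (by positivity)]
  push_cast
  calc N ^ 2 * (q (j + 2) * ((j + 2) * (j + 1))) / c ^ 2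
      = N ^ 2 / c ^ 2 * (q (j + 2) * (j + 2)) * (j + 1) := by ring
    _ ≤ N ^ 2 / c ^ 2 * (q (j + 2) * (j + 2)) * ((c + 1) * (1 + j / c)) := by gcongr
    _ = _ := by ring

lemma rescaledMeasure_univ (hq : ∀ i, 0 ≤ q i) (hm : Summable fun i : ℕ => (i : ℝ) * q i)
    (hc : 0 < c) :
    rescaledMeasure q c N Set.univ = ENNReal.ofReal (∑' j, atomWeight q c N j) := by
  rw [rescaledMeasure, Measure.sum_apply _ MeasurableSet.univ,
    ENNReal.ofReal_tsum_of_nonneg (atomWeight_nonneg hq hc) (summable_atomWeight hq hm hc)]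
  simp

lemma isFiniteMeasure_rescaledMeasure (hq : ∀ i, 0 ≤ q i)
    (hm : Summable fun i : ℕ => (i : ℝ) * q i) (hc : 0 < c) :
    IsFiniteMeasure (rescaledMeasure q c N) :=
  ⟨by rw [rescaledMeasure_univ hq hm hc]; exact ENNReal.ofReal_lt_top⟩

lemma hasSum_integral_rescaledMeasure (hq : ∀ i, 0 ≤ q i)
    (hm : Summable fun i : ℕ => (i : ℝ) * q i) (hc : 0 < c) {f : ℝ≥0∞ → ℝ} (hf : Continuous f) :
    HasSum (fun j : ℕ => atomWeight q c N j * f (ENNReal.ofReal (j / c)))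
      (∫ v, f v ∂rescaledMeasure q c N) := by
  have := isFiniteMeasure_rescaledMeasure (N := N) hq hm hc
  have hint : Integrable f (rescaledMeasure q c N) :=
    (BoundedContinuousFunction.mkOfCompact ⟨_, hf⟩).integrable _
  have h := hasSum_integral_measure hint
  simpa [ENNReal.toReal_ofReal (atomWeight_nonneg hq hc _)] using! h

lemma summable_of_tsum_eq_one (hq1 : ∑' i, q i = 1) : Summable q := by
  by_contra h
  rw [tsum_eq_zero_of_not_summable h] at hq1
  exact zero_ne_one hq1

lemma hasSum_pgf_remainder (hq : ∀ i, 0 ≤ q i) (hq1 : ∑' i, q i = 1)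
    (hm : Summable fun i : ℕ => (i : ℝ) * q i) {y : ℝ} (hy0 : 0 ≤ y) (hy1 : y ≤ 1) :
    HasSum (fun j : ℕ => q (j + 2) * ((j + 2) * (j + 1)) * y ^ 2 * powKernel j y)
      (pgf q (1 - y) - 1 + pgfMean q * y) := by
  have hqs := summable_of_tsum_eq_one hq1
  have h1 : Summable fun i => q i * (1 - y) ^ i := by
    refine Summable.of_nonneg_of_le (fun i => ?_) (fun i => ?_) hqs
    · exact mul_nonneg (hq i) (pow_nonneg (by linarith) i)
    · exact mul_le_of_le_one_right (hq i) (pow_le_one₀ (by linarith) (by linarith))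
  have h2 : HasSum (fun i : ℕ => q i * (1 - y) ^ i - q i + (i : ℝ) * q i * y)
      (pgf q (1 - y) - 1 + pgfMean q * y) :=
    (h1.hasSum.sub (hq1 ▸ hqs.hasSum)).add (hm.hasSum.mul_right y)
  have h3 := (hasSum_nat_add_iff' 2).2 h2
  simp only [Finset.sum_range_succ, Finset.sum_range_zero] at h3
  convert! h3 using 1
  · ext j
    have := one_sub_pow_taylor j y
    push_cast
    linear_combination (-q (j + 2)) * this
  · push_cast
    ring

lemma integral_levyKernel_rescaledMeasure_bounds (hq : ∀ i, 0 ≤ q i) (hq1 : ∑' i, q i = 1)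
    (hm : Summable fun i : ℕ => (i : ℝ) * q i) {l : ℝ} (hl : 0 < l) (hlc : l < c) :
    N ^ 2 * (pgf q (1 - l / c) - 1 + pgfMean q * (l / c)) ≤
        ∫ v, levyKernel l v ∂rescaledMeasure q c N ∧
      (1 - l / c) ^ 2 * ∫ v, levyKernel l v ∂rescaledMeasure q c N ≤
        N ^ 2 * (pgf q (1 - l / c) - 1 + pgfMean q * (l / c)) := by
  have hc : 0 < c := hl.trans hlc
  have hy0 : 0 ≤ l / c := by positivity
  have hy1 : l / c < 1 := (div_lt_one hc).2 hlc
  have h1 := (hasSum_pgf_remainder hq hq1 hm hy0 hy1.le).mul_left (N ^ 2)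
  have h2 := hasSum_integral_rescaledMeasure (N := N) hq hm hc (continuous_levyKernel hl)
  have key : ∀ j : ℕ, atomWeight q c N j * levyKernel l (ENNReal.ofReal (j / c)) =
      N ^ 2 * (q (j + 2) * ((j + 2) * (j + 1)) * (l / c) ^ 2 * expKernel (j * (l / c))) := by
    intro j
    have h : l * (j / c) = j * (l / c) := by ring
    have h0 : (1 + j / c) ≠ 0 := by positivity
    rw [levyKernel, extendTop, if_neg ENNReal.ofReal_ne_top,
      ENNReal.toReal_ofReal (by positivity), atomWeight, h]
    field_simp
  simp only [key] at h2
  refine ⟨hasSum_le (fun j => ?_) h1 h2, hasSum_le (fun j => ?_) (h2.mul_left _) h1⟩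
  · have := hq (j + 2)
    gcongr
    exact powKernel_le_expKernel j hy1
  · have hqj := hq (j + 2)
    calc _ = N ^ 2 * (q (j + 2) * ((j + 2) * (j + 1)) * (l / c) ^ 2 *
          ((1 - l / c) ^ 2 * expKernel (j * (l / c)))) := by ring
      _ ≤ _ := by
        gcongr
        exact expKernel_le_powKernel j hy0 hy1

/-- The cutoff `v ↦ 1 / (1 + kv)` on `[0, ∞]`. -/
noncomputable def cutoff (k : ℝ) : ℝ≥0∞ → ℝ := extendTop (fun v => (1 + k * v)⁻¹) 0

lemma continuous_cutoff {k : ℝ} (hk : 0 < k) : Continuous (cutoff k) := by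
  refine continuous_extendTop (ContinuousOn.inv₀ (by fun_prop) fun v hv => ?_) ?_
  · have hv : 0 ≤ v := hv
    positivity
  · exact tendsto_inv_atTop_zero.comp
      (tendsto_atTop_add_const_left _ _ (tendsto_id.const_mul_atTop hk))

lemma pgfMean_sub_one_le (hq : ∀ i, 0 ≤ q i) (hq1 : ∑' i, q i = 1)
    (hm : Summable fun i : ℕ => (i : ℝ) * q i) {k : ℝ} (hk : 0 < k) (hkc : k ≤ c) :
    N ^ 2 / c ^ 2 * (pgfMean q - 1) ≤
      ∫ v, cutoff k v ∂rescaledMeasure q c N + (∑' j, atomWeight q c N j) * c⁻¹ := by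
  have hc : 0 < c := hk.trans_le hkc
  have hqs := summable_of_tsum_eq_one hq1
  have h1 : HasSum (fun i : ℕ => (i : ℝ) * q i - q i) (pgfMean q - 1) :=
    hm.hasSum.sub (hq1 ▸ hqs.hasSum)
  have h2 := (hasSum_nat_add_iff' 2).2 h1
  simp only [Finset.sum_range_succ, Finset.sum_range_zero] at h2
  have h3 := (hasSum_integral_rescaledMeasure (N := N) hq hm hc (continuous_cutoff hk)).add
    ((summable_atomWeight (N := N) hq hm hc).hasSum.mul_right c⁻¹)
  refine le_trans ?_ (hasSum_le (fun j => ?_) (h2.mul_left (N ^ 2 / c ^ 2)) h3)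
  · have := hq 0
    refine mul_le_mul_of_nonneg_left ?_ (by positivity)
    push_cast
    linarith
  · have hqj := hq (j + 2)
    have hbound : 1 + j / c ≤ (j + 2) * ((1 + k * (j / c))⁻¹ + c⁻¹) := by
      have e1 : (1 : ℝ) ≤ (j + 2) * (1 + k * (j / c))⁻¹ := by
        have : k * (j / c) ≤ j := by
          rw [mul_div_assoc', div_le_iff₀ hc, mul_comm]
          gcongr
        rw [← div_eq_mul_inv, one_le_div (by positivity)]
        linarith
      have e2 : (j : ℝ) / c ≤ (j + 2) * c⁻¹ := by
        rw [div_eq_mul_inv]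
        gcongr
        linarith
      linarith
    rw [cutoff, extendTop, if_neg ENNReal.ofReal_ne_top, ENNReal.toReal_ofReal (by positivity),
      ← mul_add, atomWeight, div_mul_eq_mul_div (_ / _) (1 + (j : ℝ) / c), le_div_iff₀ (by positivity)]
    push_cast
    calc _ = N ^ 2 / c ^ 2 * (q (j + 2) * (j + 1)) * (1 + j / c) := by ring
      _ ≤ N ^ 2 / c ^ 2 * (q (j + 2) * (j + 1)) *
          ((j + 2) * ((1 + k * (j / c))⁻¹ + c⁻¹)) := by gcongr
      _ = _ := by ring

end Rescaled

lemma le_measureReal_singleton_zero {ρ : Measure ℝ≥0∞} [IsFiniteMeasure ρ] {b : ℝ}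
    (h : ∀ k : ℕ, b ≤ ∫ v, cutoff (k + 1) v ∂ρ) : b ≤ ρ.real {0} := by
  have hlim : Tendsto (fun k : ℕ => ∫ v, cutoff (k + 1) v ∂ρ) atTop
      (𝓝 (∫ v, Set.indicator {0} (fun _ => (1 : ℝ)) v ∂ρ)) := by
    refine tendsto_integral_of_dominated_convergence (fun _ => 1) (fun k => ?_)
      (integrable_const _) (fun k => ae_of_all _ fun v => ?_) (ae_of_all _ fun v => ?_)
    · exact (continuous_cutoff (by positivity)).aestronglyMeasurable
    · rw [cutoff, extendTop]
      split_ifs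
      · simp
      · have hv : 0 ≤ v.toReal := ENNReal.toReal_nonneg
        rw [Real.norm_of_nonneg (by positivity)]
        exact inv_le_one_of_one_le₀ (le_add_of_nonneg_right (by positivity))
    · by_cases hv : v = 0
      · simp [hv, cutoff, extendTop]
      · simp only [cutoff, extendTop, Set.mem_singleton_iff, hv, not_false_eq_true,
          Set.indicator_of_notMem]
        split_ifs with ht
        · exact tendsto_const_nhds
        · refine tendsto_inv_atTop_zero.comp (tendsto_atTop_add_const_left _ _ ?_)
          refine Tendsto.atTop_mul_const (ENNReal.toReal_pos hv ht) ?_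
          exact tendsto_atTop_add_const_right _ _ tendsto_natCast_atTop_atTop
  rw [integral_indicator_const _ (measurableSet_singleton 0), smul_eq_mul, mul_one] at hlim
  exact ge_of_tendsto' hlim h

lemma tendsto_atTop_of_tendsto_div_sq {c : ℕ → ℝ} (hc : ∀ n, 0 < c n) {γ : ℝ} (hγ : 0 ≤ γ)
    (h : Tendsto (fun n : ℕ => (n : ℝ) / c n ^ 2) atTop (𝓝 γ)) : Tendsto c atTop atTop := by
  have hγ1 : 0 < γ + 1 := by linarith
  have h1 : Tendsto (fun n => c n ^ 2) atTop atTop := by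
    refine tendsto_atTop_mono' atTop ?_ (tendsto_natCast_atTop_atTop.atTop_div_const hγ1)
    filter_upwards [h.eventually_le_const (lt_add_one γ)] with n hn
    rw [div_le_iff₀ (pow_pos (hc n) 2)] at hn
    rw [div_le_iff₀ hγ1]
    linarith
  refine (Real.tendsto_sqrt_atTop.comp h1).congr fun n => ?_
  exact Real.sqrt_sq (hc n).le

lemma tendsto_integral_levyKernel {p : ℕ → ℕ → ℝ} (hp0 : ∀ n i, 0 ≤ p n i)
    (hp1 : ∀ n, ∑' i, p n i = 1) (hpm : ∀ n, Summable fun i : ℕ => (i : ℝ) * p n i)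
    {c : ℕ → ℝ} (hc : Tendsto c atTop atTop) {l g : ℝ} (hl : 0 < l)
    (hg : Tendsto (fun n => Gseq p c n l) atTop (𝓝 g)) :
    Tendsto (fun n : ℕ => ∫ v, levyKernel l v ∂rescaledMeasure (p n) (c n) n) atTop (𝓝 (-g)) := by
  have hG : ∀ n, -Gseq p c n l =
      (n : ℝ) ^ 2 * (pgf (p n) (1 - l / c n) - 1 + pgfMean (p n) * (l / c n)) := fun n => by
    rw [Gseq]; ring
  have hfac : Tendsto (fun n => (1 - l / c n) ^ 2) atTop (𝓝 1) := by
    simpa using ((hc.const_div_atTop l).const_sub 1).pow 2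
  have hupper : Tendsto (fun n => -Gseq p c n l / (1 - l / c n) ^ 2) atTop (𝓝 (-g)) := by
    simpa using! hg.neg.div hfac one_ne_zero
  refine tendsto_of_tendsto_of_tendsto_of_le_of_le' hg.neg hupper ?_ ?_
  · filter_upwards [hc.eventually_gt_atTop l] with n hn
    rw [hG]
    exact (integral_levyKernel_rescaledMeasure_bounds (hp0 n) (hp1 n) (hpm n) hl hn).1
  · filter_upwards [hc.eventually_gt_atTop l] with n hn
    have hy : l / c n < 1 := (div_lt_one (hl.trans hn)).2 hn
    rw [le_div_iff₀ (pow_pos (by linarith) 2), mul_comm, hG]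
    exact (integral_levyKernel_rescaledMeasure_bounds (hp0 n) (hp1 n) (hpm n) hl hn).2

lemma Gseq_zero {p : ℕ → ℕ → ℝ} (hp1 : ∀ n, ∑' i, p n i = 1) (c : ℕ → ℝ) (n : ℕ) :
    Gseq p c n 0 = 0 := by
  simp [Gseq, pgf, hp1]

lemma exists_bound_tsum_atomWeight {p : ℕ → ℕ → ℝ} (hp0 : ∀ n i, 0 ≤ p n i)
    (hpm : ∀ n, Summable fun i : ℕ => (i : ℝ) * p n i) {c : ℕ → ℝ} (hc : ∀ n, 0 < c n) {b : ℝ}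
    (h : Tendsto (fun n : ℕ => ∫ v, levyKernel 1 v ∂rescaledMeasure (p n) (c n) n) atTop (𝓝 b)) :
    ∃ C : NNReal, ∀ᶠ n : ℕ in atTop, ∑' j, atomWeight (p n) (c n) n j ≤ C := by
  obtain ⟨δ, hδ, hle⟩ := exists_le_levyKernel_one
  refine ⟨((b + 1) / δ).toNNReal, ?_⟩
  filter_upwards [h.eventually_le_const (lt_add_one b)] with n hn
  refine le_trans ?_ (Real.le_coe_toNNReal _)
  rw [le_div_iff₀ hδ]
  refine le_trans ?_ hn
  exact hasSum_le (fun j => mul_le_mul_of_nonneg_left (hle _) (atomWeight_nonneg (hp0 n) (hc n) j))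
    ((summable_atomWeight (hp0 n) (hpm n) (hc n)).hasSum.mul_right δ)
    (hasSum_integral_rescaledMeasure (hp0 n) (hpm n) (hc n) (continuous_levyKernel one_pos))

/-- The rescaled measures have a weak cluster point, expressed along an ultrafilter. -/
lemma exists_ultrafilter_tendsto_rescaledMeasure {p : ℕ → ℕ → ℝ} (hp0 : ∀ n i, 0 ≤ p n i)
    (hpm : ∀ n, Summable fun i : ℕ => (i : ℝ) * p n i) {c : ℕ → ℝ} (hc : ∀ n, 0 < c n) {C : NNReal}
    (hC : ∀ᶠ n : ℕ in atTop, ∑' j, atomWeight (p n) (c n) n j ≤ C) :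
    ∃ (U : Ultrafilter ℕ) (ρ : Measure ℝ≥0∞), (U : Filter ℕ) ≤ atTop ∧ IsFiniteMeasure ρ ∧
      ∀ f : ℝ≥0∞ → ℝ, Continuous f →
        Tendsto (fun n : ℕ => ∫ v, f v ∂rescaledMeasure (p n) (c n) n) U (𝓝 (∫ v, f v ∂ρ)) := by
  let R : ℕ → FiniteMeasure ℝ≥0∞ := fun n =>
    ⟨rescaledMeasure (p n) (c n) n, isFiniteMeasure_rescaledMeasure (hp0 n) (hpm n) (hc n)⟩
  have hU : ((Ultrafilter.of atTop : Ultrafilter ℕ) : Filter ℕ) ≤ atTop := Ultrafilter.of_le _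
  have hR : ∀ᶠ n in atTop, R n ∈ {μ : FiniteMeasure ℝ≥0∞ | μ.mass ≤ C} := by
    filter_upwards [hC] with n hn
    rw [← ENNReal.coe_le_coe, FiniteMeasure.ennreal_mass]
    change rescaledMeasure (p n) (c n) n Set.univ ≤ C
    rw [rescaledMeasure_univ (hp0 n) (hpm n) (hc n)]
    exact ENNReal.ofReal_le_of_le_toReal hn
  obtain ⟨ρ, -, hρ⟩ :=
    (isCompact_setOfPred_finiteMeasure_le_of_compactSpace ℝ≥0∞ C).ultrafilter_le_nhds
      ((Ultrafilter.of atTop).map R) (le_principal_iff.2 (hU hR))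
  refine ⟨Ultrafilter.of atTop, ρ, hU, inferInstance, fun f hf => ?_⟩
  exact (FiniteMeasure.tendsto_iff_forall_integral_tendsto (μs := R)).1 hρ
    (BoundedContinuousFunction.mkOfCompact ⟨f, hf⟩)

theorem stmt2
    (p : ℕ → ℕ → ℝ)
    (hp0 : ∀ n i, 0 ≤ p n i) (hp1 : ∀ n, ∑' i, p n i = 1)
    -- the offspring means `m_n` are finite
    (hpm : ∀ n, Summable fun i : ℕ => (i : ℝ) * p n i)
    (c : ℕ → ℝ) (hcpos : ∀ n, 0 < c n)
    (γ₀ a : ℝ) (hγ₀ : 0 ≤ γ₀)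
    -- condition (C)
    (hC1 : Tendsto (fun n : ℕ => (n : ℝ) / c n) atTop atTop)
    (hC2 : Tendsto (fun n : ℕ => (n : ℝ) / c n ^ 2) atTop (𝓝 γ₀))
    -- condition (D1)
    (hD1 : Tendsto (fun n : ℕ => (n : ℝ) * (pgfMean (p n) - 1)) atTop (𝓝 a))
    -- condition (D2)
    (G : ℝ → ℝ)
    (hGlip : ∀ M > (0 : ℝ), ∃ K : ℝ, ∀ (n : ℕ) (l l' : ℝ),
      l ∈ Set.Icc 0 M → l' ∈ Set.Icc 0 M → l ≤ c n → l' ≤ c n →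
      |Gseq p c n l - Gseq p c n l'| ≤ K * |l - l'|)
    (hGlim : ∀ l : ℝ, 0 ≤ l → Tendsto (fun n => Gseq p c n l) atTop (𝓝 (G l)))
    (hGcont : ContinuousOn G (Set.Ici 0)) :
    ∃ (β₁ σ₁ : ℝ) (μm : Measure ℝ), 0 ≤ σ₁ ∧ a * γ₀ ≤ 2 * σ₁ ∧
      SigmaFinite μm ∧ μm (Set.Iic 0) = 0 ∧
      (∫⁻ u in Set.Ioi (0 : ℝ), ENNReal.ofReal (min u (u ^ 2)) ∂μm) < ⊤ ∧
      ∀ l : ℝ, 0 ≤ l →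
        G l = β₁ * l - σ₁ * l ^ 2
          - ∫ u in Set.Ioi (0 : ℝ), (Real.exp (-l * u) - 1 + l * u) ∂μm := by
  have hc := tendsto_atTop_of_tendsto_div_sq hcpos hγ₀ hC2
  have hlim := fun l hl => tendsto_integral_levyKernel hp0 hp1 hpm hc hl (hGlim l (le_of_lt hl))
  obtain ⟨C, hC⟩ := exists_bound_tsum_atomWeight hp0 hpm hcpos (hlim 1 one_pos)
  obtain ⟨U, ρ, hU, hρfin, hρ⟩ := exists_ultrafilter_tendsto_rescaledMeasure hp0 hpm hcpos hC
  have hatom : a * γ₀ ≤ ρ.real {0} := by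
    refine le_measureReal_singleton_zero fun k => ?_
    have hk : (0 : ℝ) < k + 1 := by positivity
    have h1 : Tendsto (fun n : ℕ => (n : ℝ) ^ 2 / c n ^ 2 * (pgfMean (p n) - 1)) U
        (𝓝 (a * γ₀)) := by
      refine ((hD1.mul hC2).mono_left hU).congr fun n => ?_
      ring
    have h2 : Tendsto (fun n : ℕ => ∫ v, cutoff (k + 1) v ∂rescaledMeasure (p n) (c n) n +
        C * (c n)⁻¹) U (𝓝 (∫ v, cutoff (k + 1) v ∂ρ + C * 0)) :=
      (hρ _ (continuous_cutoff hk)).add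
        ((hc.inv_tendsto_atTop.mono_left hU).const_mul _)
    rw [mul_zero, add_zero] at h2
    refine le_of_tendsto_of_tendsto h1 h2 (hU ?_)
    filter_upwards [hC, hc.eventually_ge_atTop ((k : ℝ) + 1)] with n hn hkn
    refine (pgfMean_sub_one_le (hp0 n) (hp1 n) (hpm n) hk hkn).trans ?_
    have := inv_pos.2 (hcpos n)
    gcongr
  refine ⟨-ρ.real {⊤}, ρ.real {0} / 2, levyMeasure ρ, by positivity, by linarith,
    sigmaFinite_levyMeasure ρ, levyMeasure_Iic ρ, lintegral_levyMeasure_lt_top ρ, fun l hl => ?_⟩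
  rcases hl.eq_or_lt with rfl | hl
  · have h0 : G 0 = 0 := by
      refine tendsto_nhds_unique (hGlim 0 le_rfl) ?_
      simp only [Gseq_zero hp1]
      exact tendsto_const_nhds
    simp [h0]
  · have h := tendsto_nhds_unique ((hlim l hl).mono_left hU) (hρ _ (continuous_levyKernel hl))
    rw [integral_levyKernel ρ hl] at h
    linarith
end
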